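/- Let δ ∈ ℝ and 1 ≤ p < ∞. If δ < 2p − 1, then the logarithmic Hardy operator H₀^{1,log} is bounded on L^p(ℝ₊, x^δ dx). If δ ≥ 2p − 1, then H₀^{1,log} is not of restricted weak type (p,p) with respect to (ℝ₊, x^δ dx). -/

import Mathlib

open MeasureTheory Set ENNReal
open scoped NNReal

noncomputable section

/-- The measure `x^δ dx` on `(0,∞)`. -/
def powMeasure (δ : ℝ) : Measure ℝ :=
  (volume.restrict (Ioi (0:ℝ))).withDensity (fun x => ENNReal.ofReal (x ^ δ))

/-- `f ∈ L^p(ℝ₊, x^δ dx)` for a real exponent `p`. -/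
def MemLpPow (f : ℝ → ℝ) (p δ : ℝ) : Prop :=
  AEMeasurable f (powMeasure δ) ∧
    ∫⁻ x, ENNReal.ofReal |f x| ^ p ∂(powMeasure δ) < ⊤

/-- `T` is of strong type `(p,p)` with respect to `(ℝ₊, x^δ dx)`. -/
def IsStrongType (T : (ℝ → ℝ) → (ℝ → ℝ)) (p δ : ℝ) : Prop :=
  ∃ C : ℝ≥0, ∀ f : ℝ → ℝ, MemLpPow f p δ →
    ∫⁻ x, ENNReal.ofReal |T f x| ^ p ∂(powMeasure δ) ≤
      C * ∫⁻ x, ENNReal.ofReal |f x| ^ p ∂(powMeasure δ)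

/-- `T` is of strong type `(∞,∞)`, i.e. bounded on `L^∞(ℝ₊, dx)`. -/
def IsStrongTypeInfty (T : (ℝ → ℝ) → (ℝ → ℝ)) : Prop :=
  ∃ C : ℝ≥0, ∀ f : ℝ → ℝ,
    eLpNorm (T f) ⊤ (volume.restrict (Ioi (0:ℝ))) ≤
      C * eLpNorm f ⊤ (volume.restrict (Ioi (0:ℝ)))

/-- `T` is of weak type `(p,p)` with respect to `(ℝ₊, x^δ dx)`. -/
def IsWeakType (T : (ℝ → ℝ) → (ℝ → ℝ)) (p δ : ℝ) : Prop :=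
  ∃ C : ℝ≥0, ∀ f : ℝ → ℝ, MemLpPow f p δ → ∀ l : ℝ, 0 < l →
    ENNReal.ofReal (l ^ p) * powMeasure δ {y | l < |T f y|} ≤
      C * ∫⁻ x, ENNReal.ofReal |f x| ^ p ∂(powMeasure δ)

/-- `T` is of restricted weak type `(p,p)` with respect to `(ℝ₊, x^δ dx)`:
the weak type inequality holds uniformly over indicator functions of sets of
finite `x^δ dx` measure. -/
def IsRestrictedWeakType (T : (ℝ → ℝ) → (ℝ → ℝ)) (p δ : ℝ) : Prop :=
  ∃ C : ℝ≥0, ∀ E : Set ℝ, MeasurableSet E → powMeasure δ E < ⊤ → ∀ l : ℝ, 0 < l →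
    ENNReal.ofReal (l ^ p) * powMeasure δ {y | l < |T (E.indicator 1) y|} ≤
      C * powMeasure δ E

/-- The logarithmic Hardy operator `H₀^{1,log}`. -/
def H0log (f : ℝ → ℝ) (x : ℝ) : ℝ :=
  x ^ (-2 : ℝ) * ∫ y in Ioo (0:ℝ) x, Real.log (x / y) * f y * y

lemma measurable_ofReal_rpow (s : ℝ) : Measurable fun x : ℝ => ENNReal.ofReal (x ^ s) := by
  fun_prop

lemma lintegral_powMeasure (δ : ℝ) {g : ℝ → ℝ≥0∞} (hg : Measurable g) :
    ∫⁻ x, g x ∂(powMeasure δ) = ∫⁻ x in Ioi (0:ℝ), ENNReal.ofReal (x ^ δ) * g x := by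
  rw [powMeasure, lintegral_withDensity_eq_lintegral_mul _ (measurable_ofReal_rpow δ) hg]
  rfl

lemma ae_restrict_Ioi_of_ae_powMeasure {δ : ℝ} {q : ℝ → Prop} (h : ∀ᵐ x ∂(powMeasure δ), q x) :
    ∀ᵐ x ∂(volume.restrict (Ioi (0:ℝ))), q x := by
  rw [powMeasure, ae_withDensity_iff (measurable_ofReal_rpow δ)] at h
  filter_upwards [h, ae_restrict_mem measurableSet_Ioi] with x hx hx0
  exact hx (ENNReal.ofReal_pos.2 (Real.rpow_pos_of_pos hx0 δ)).ne'

lemma ae_powMeasure_pos (δ : ℝ) : ∀ᵐ x ∂(powMeasure δ), 0 < x :=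
  (withDensity_absolutelyContinuous _ _).ae_le (ae_restrict_mem measurableSet_Ioi)

lemma powMeasure_apply (δ : ℝ) {E : Set ℝ} (hE : MeasurableSet E) (hE0 : E ⊆ Ioi 0) :
    powMeasure δ E = ∫⁻ x in E, ENNReal.ofReal (x ^ δ) := by
  rw [powMeasure, withDensity_apply _ hE, Measure.restrict_restrict hE,
    inter_eq_self_of_subset_left hE0]

lemma lintegral_comp_mul_left_Ioi (g : ℝ → ℝ≥0∞) (hg : Measurable g) {t : ℝ} (ht : 0 < t) :
    ∫⁻ x in Ioi (0:ℝ), g (t * x) = ENNReal.ofReal t⁻¹ * ∫⁻ x in Ioi (0:ℝ), g x := by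
  rw [← lintegral_indicator measurableSet_Ioi, ← lintegral_indicator measurableSet_Ioi]
  have h := Real.map_volume_mul_left ht.ne'
  rw [abs_of_pos (inv_pos.2 ht)] at h
  rw [← smul_eq_mul, ← lintegral_smul_measure, ← h,
    lintegral_map (hg.indicator measurableSet_Ioi) (measurable_const_mul t)]
  congr 1 with x
  simp [indicator, ht]

lemma lintegral_powMeasure_comp_mul_left (δ : ℝ) {g : ℝ → ℝ≥0∞} (hg : Measurable g) {t : ℝ}
    (ht : 0 < t) :
    ∫⁻ x, g (t * x) ∂(powMeasure δ) =
      ENNReal.ofReal (t ^ (-(δ + 1))) * ∫⁻ x, g x ∂(powMeasure δ) := by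
  rw [lintegral_powMeasure δ (g := fun x => g (t * x)) (hg.comp (measurable_const_mul t)),
    lintegral_powMeasure δ hg]
  have h := lintegral_comp_mul_left_Ioi (fun x => ENNReal.ofReal (x ^ δ) * g x)
    ((measurable_ofReal_rpow δ).mul hg) ht
  have e : ∫⁻ x in Ioi (0:ℝ), ENNReal.ofReal (x ^ δ) * g (t * x) =
      ENNReal.ofReal (t ^ (-δ)) * ∫⁻ x in Ioi (0:ℝ), ENNReal.ofReal ((t * x) ^ δ) * g (t * x) := by
    rw [← lintegral_const_mul _ (by fun_prop)]
    refine setLIntegral_congr_fun measurableSet_Ioi fun x hx => ?_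
    rw [← mul_assoc, ← ENNReal.ofReal_mul (by positivity), Real.mul_rpow ht.le (le_of_lt hx),
      ← mul_assoc, ← Real.rpow_add ht]
    simp
  rw [e, h, ← mul_assoc, ← ENNReal.ofReal_mul (by positivity)]
  congr 3
  rw [neg_add, Real.rpow_add ht, Real.rpow_neg_one]

/-- The kernel of `H₀^{1,log}` in the dilation variable, weighted by `t^{-a}`. -/
def logKernel (a t : ℝ) : ℝ≥0∞ := ENNReal.ofReal (Real.log t⁻¹ * t ^ (1 - a))

@[fun_prop]
lemma measurable_logKernel (a : ℝ) : Measurable (logKernel a) := by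
  unfold logKernel; fun_prop

lemma lintegral_logKernel_lt_top {a : ℝ} (ha : a < 2) :
    ∫⁻ t in Ioo (0:ℝ) 1, logKernel a t < ⊤ := by
  set ε := (2 - a) / 2 with hε
  have hε0 : 0 < ε := by rw [hε]; linarith
  have hint : IntegrableOn (fun t : ℝ => ε⁻¹ * t ^ (-1 + ε)) (Ioo (0:ℝ) 1) :=
    ((intervalIntegral.integrableOn_Ioo_rpow_iff one_pos).2 (by linarith)).const_mul _
  refine lt_of_le_of_lt (setLIntegral_mono (by fun_prop) fun t ht => ?_) hint.lintegral_lt_top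
  refine ENNReal.ofReal_le_ofReal ?_
  have h0 : 0 < t := ht.1
  calc Real.log t⁻¹ * t ^ (1 - a) ≤ (t⁻¹ ^ ε / ε) * t ^ (1 - a) := by
        gcongr
        exact Real.log_le_rpow_div (by positivity) hε0
    _ = ε⁻¹ * t ^ (-1 + ε) := by
        rw [Real.inv_rpow h0.le, ← Real.rpow_neg h0.le, div_mul_eq_mul_div, ← Real.rpow_add h0,
          div_eq_inv_mul]
        congr 2
        rw [hε]; ring

lemma ofReal_abs_H0log_le (f : ℝ → ℝ) (a : ℝ) {x : ℝ} (hx : 0 < x) :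
    ENNReal.ofReal |H0log f x| ≤
      ∫⁻ t in Ioo (0:ℝ) 1, logKernel a t * ENNReal.ofReal (t ^ a * |f (t * x)|) := by
  have h : H0log f x = ∫ t in Ioo (0:ℝ) 1, Real.log t⁻¹ * f (t * x) * t := by
    have := intervalIntegral.integral_comp_mul_left (a := 0) (b := 1)
      (fun y => Real.log (x / y) * f y * y) hx.ne'
    rw [mul_zero, mul_one, intervalIntegral.integral_of_le hx.le,
      intervalIntegral.integral_of_le zero_le_one, integral_Ioc_eq_integral_Ioo,
      integral_Ioc_eq_integral_Ioo] at this
    have e : ∫ t in Ioo (0:ℝ) 1, Real.log (x / (x * t)) * f (x * t) * (x * t) =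
        x * ∫ t in Ioo (0:ℝ) 1, Real.log t⁻¹ * f (t * x) * t := by
      rw [← integral_const_mul]
      congr 1 with t
      rw [mul_comm x t, div_mul_cancel_right₀ hx.ne']
      ring
    rw [e, smul_eq_mul] at this
    rw [H0log, Real.rpow_neg hx.le, Real.rpow_two]
    field_simp at this ⊢
    exact this.symm
  rw [h, ← Real.enorm_eq_ofReal_abs]
  refine (enorm_integral_le_lintegral_enorm _).trans
    (setLIntegral_mono' measurableSet_Ioo fun t ht => ?_)
  have h0 : 0 < t := ht.1
  have hl : 0 ≤ Real.log t⁻¹ := Real.log_nonneg ((one_le_inv₀ h0).2 ht.2.le)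
  rw [Real.enorm_eq_ofReal_abs, logKernel, ← ENNReal.ofReal_mul (by positivity), abs_mul, abs_mul,
    abs_of_nonneg hl, abs_of_pos h0]
  refine ENNReal.ofReal_le_ofReal (le_of_eq ?_)
  have : t = t ^ (1 - a) * t ^ a := by rw [← Real.rpow_add h0]; simp
  calc _ = Real.log t⁻¹ * |f (t * x)| * (t ^ (1 - a) * t ^ a) := by rw [← this]
    _ = _ := by ring

lemma lintegral_rpow_le_measure_univ_mul {α : Type*} [MeasurableSpace α] {ν : Measure α}
    {g : α → ℝ≥0∞} (hg : Measurable g) {p : ℝ} (hp : 1 ≤ p) :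
    (∫⁻ t, g t ∂ν) ^ p ≤ ν univ ^ (p - 1) * ∫⁻ t, g t ^ p ∂ν := by
  have h := eLpNorm'_le_eLpNorm'_mul_rpow_measure_univ one_pos hp (μ := ν) (f := g)
    hg.aestronglyMeasurable
  have hp0 : 0 < p := by linarith
  simp only [eLpNorm', enorm_eq_self, ENNReal.rpow_one, div_one] at h
  refine (ENNReal.rpow_le_rpow h hp0.le).trans (le_of_eq ?_)
  rw [ENNReal.mul_rpow_of_nonneg _ _ hp0.le, ← ENNReal.rpow_mul, ← ENNReal.rpow_mul,
    one_div_mul_cancel hp0.ne', ENNReal.rpow_one, mul_comm]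
  congr 2
  field_simp

lemma lintegral_H0log_rpow_le {δ p : ℝ} (hp : 1 ≤ p) {f : ℝ → ℝ} (hf : Measurable f) :
    ∫⁻ x, ENNReal.ofReal |H0log f x| ^ p ∂(powMeasure δ) ≤
      (∫⁻ t in Ioo (0:ℝ) 1, logKernel ((δ + 1) / p) t) ^ p *
        ∫⁻ x, ENNReal.ofReal |f x| ^ p ∂(powMeasure δ) := by
  have hp0 : 0 < p := by linarith
  set a := (δ + 1) / p with ha
  set c := ∫⁻ t in Ioo (0:ℝ) 1, logKernel a t with hc
  have : SFinite (powMeasure δ) := by unfold powMeasure; infer_instance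
  have pointwise : ∀ x : ℝ, 0 < x → ENNReal.ofReal |H0log f x| ^ p ≤
      c ^ (p - 1) * ∫⁻ t in Ioo (0:ℝ) 1,
        logKernel a t * ENNReal.ofReal (t ^ a * |f (t * x)|) ^ p := by
    intro x hx
    refine (ENNReal.rpow_le_rpow (ofReal_abs_H0log_le f a hx) hp0.le).trans ?_
    have h := lintegral_rpow_le_measure_univ_mul
      (ν := (volume.restrict (Ioo (0:ℝ) 1)).withDensity (logKernel a))
      (g := fun t => ENNReal.ofReal (t ^ a * |f (t * x)|)) (by fun_prop) hp
    rw [lintegral_withDensity_eq_lintegral_mul _ (by fun_prop) (by fun_prop),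
      lintegral_withDensity_eq_lintegral_mul _ (by fun_prop) (by fun_prop),
      withDensity_apply _ MeasurableSet.univ, Measure.restrict_univ] at h
    exact h
  calc _ ≤ ∫⁻ x, (c ^ (p - 1) * ∫⁻ t in Ioo (0:ℝ) 1,
        logKernel a t * ENNReal.ofReal (t ^ a * |f (t * x)|) ^ p) ∂(powMeasure δ) := by
        refine lintegral_mono_ae ?_
        filter_upwards [ae_powMeasure_pos δ] with x hx using pointwise x hx
    _ = c ^ (p - 1) * ∫⁻ t in Ioo (0:ℝ) 1, ∫⁻ x,
        logKernel a t * ENNReal.ofReal (t ^ a * |f (t * x)|) ^ p ∂(powMeasure δ) := by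
        rw [lintegral_const_mul, lintegral_lintegral_swap]
        · exact Measurable.aemeasurable (by fun_prop)
        · refine Measurable.lintegral_prod_right' (f := fun z : ℝ × ℝ =>
            logKernel a z.2 * ENNReal.ofReal (z.2 ^ a * |f (z.2 * z.1)|) ^ p) ?_
          fun_prop
    _ = c ^ (p - 1) * ∫⁻ t in Ioo (0:ℝ) 1,
        logKernel a t * ∫⁻ x, ENNReal.ofReal |f x| ^ p ∂(powMeasure δ) := by
        congr 1
        refine setLIntegral_congr_fun measurableSet_Ioo fun t ht => ?_
        have h0 : 0 < t := ht.1
        rw [lintegral_const_mul _ (by fun_prop)]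
        congr 1
        have e : ∀ x, ENNReal.ofReal (t ^ a * |f (t * x)|) ^ p =
            ENNReal.ofReal (t ^ (δ + 1)) * ENNReal.ofReal |f (t * x)| ^ p := by
          intro x
          rw [ENNReal.ofReal_mul (by positivity), ENNReal.mul_rpow_of_nonneg _ _ hp0.le,
            ENNReal.ofReal_rpow_of_nonneg (by positivity) hp0.le, ← Real.rpow_mul h0.le, ha,
            div_mul_cancel₀ _ hp0.ne']
        simp_rw [e]
        rw [lintegral_const_mul _ (by fun_prop),
          lintegral_powMeasure_comp_mul_left δ (g := fun x => ENNReal.ofReal |f x| ^ p)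
            (by fun_prop) h0, ← mul_assoc, ← ENNReal.ofReal_mul (by positivity),
          ← Real.rpow_add h0]
        simp
    _ = _ := by
        rw [lintegral_mul_const _ (by fun_prop), ← hc, ← mul_assoc]
        congr 1
        nth_rewrite 2 [← ENNReal.rpow_one c]
        rw [← ENNReal.rpow_add_of_nonneg _ _ (by linarith) zero_le_one, sub_add_cancel]

lemma H0log_congr_ae {f g : ℝ → ℝ} (h : f =ᵐ[volume.restrict (Ioi (0:ℝ))] g) :
    H0log f = H0log g := by
  ext x
  unfold H0log
  congr 1
  refine integral_congr_ae ?_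
  filter_upwards [ae_restrict_of_ae_restrict_of_subset Ioo_subset_Ioi_self h] with y hy
  rw [hy]

theorem isStrongType_H0log {δ p : ℝ} (hp : 1 ≤ p) (hδ : δ < 2 * p - 1) :
    IsStrongType H0log p δ := by
  set c := (∫⁻ t in Ioo (0:ℝ) 1, logKernel ((δ + 1) / p) t) ^ p with hc
  have hp0 : 0 < p := by linarith
  have hfin : c < ⊤ :=
    ENNReal.rpow_lt_top_of_nonneg hp0.le
      (lintegral_logKernel_lt_top (by rw [div_lt_iff₀ hp0]; linarith)).ne
  refine ⟨c.toNNReal, fun f hf => ?_⟩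
  rw [ENNReal.coe_toNNReal hfin.ne]
  have hae := hf.1.ae_eq_mk
  rw [H0log_congr_ae (ae_restrict_Ioi_of_ae_powMeasure hae)]
  refine (lintegral_H0log_rpow_le hp hf.1.measurable_mk).trans (le_of_eq ?_)
  congr 1
  refine lintegral_congr_ae ?_
  filter_upwards [hae] with x hx
  rw [hx]

lemma log_div_two_le_integral {x : ℝ} (hx : 1 < x) :
    Real.log x / 2 ≤
      ∫ y in Ioo (0:ℝ) x, Real.log (x / y) * (Ioo (0:ℝ) 1).indicator 1 y * y := by
  have hx0 : 0 < x := by linarith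
  have hlog : 0 < Real.log x := Real.log_pos hx
  have hint : IntegrableOn
      (fun y => Real.log (x / y) * (Ioo (0:ℝ) 1).indicator 1 y * y) (Ioo (0:ℝ) x) := by
    refine Measure.integrableOn_of_bounded (M := x) (by simp) ?_ ?_
    · have : Measurable ((Ioo (0:ℝ) 1).indicator (1 : ℝ → ℝ)) :=
        measurable_one.indicator measurableSet_Ioo
      exact Measurable.aestronglyMeasurable (by fun_prop)
    · filter_upwards [ae_restrict_mem measurableSet_Ioo] with y hy
      have hy0 : 0 < y := hy.1
      have h1 : 0 ≤ Real.log (x / y) := Real.log_nonneg ((one_le_div hy0).2 hy.2.le)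
      have h2 : Real.log (x / y) * y ≤ x := by
        have := Real.log_le_self (x := x / y) (by positivity)
        calc _ ≤ x / y * y := by gcongr
          _ = x := by field_simp
      by_cases h : y ∈ Ioo (0:ℝ) 1
      · simpa [h, abs_of_nonneg h1, abs_of_pos hy0] using h2
      · simpa [h] using hx0.le
  have hsub : Ioo (0:ℝ) 1 ⊆ Ioo 0 x := Ioo_subset_Ioo_right hx.le
  calc Real.log x / 2 = ∫ y in Ioo (0:ℝ) 1, Real.log x * y := by
        rw [← integral_Ioc_eq_integral_Ioo, ← intervalIntegral.integral_of_le zero_le_one,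
          intervalIntegral.integral_const_mul, integral_id]
        ring
    _ ≤ ∫ y in Ioo (0:ℝ) 1, Real.log (x / y) * (Ioo (0:ℝ) 1).indicator 1 y * y := by
        refine setIntegral_mono_on ?_ (hint.mono_set hsub) measurableSet_Ioo fun y hy => ?_
        · exact (continuous_const.mul continuous_id).integrableOn_Icc.mono_set Ioo_subset_Icc_self
        · have hy0 : 0 < y := hy.1
          simp only [indicator_of_mem hy, Pi.one_apply, mul_one]
          gcongr
          rw [le_div_iff₀ hy0]
          nlinarith [hy.2]
    _ ≤ _ := by
        refine setIntegral_mono_set hint ?_ hsub.eventuallyLE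
        filter_upwards [ae_restrict_mem measurableSet_Ioo] with y hy
        have hy0 : 0 < y := hy.1
        have h1 : 0 ≤ Real.log (x / y) := Real.log_nonneg ((one_le_div hy0).2 hy.2.le)
        have : 0 ≤ (Ioo (0:ℝ) 1).indicator (1 : ℝ → ℝ) y := indicator_nonneg (by simp) y
        simp only [Pi.zero_apply]
        positivity

lemma powMeasure_Ioo_zero_one_lt_top {δ : ℝ} (hδ : -1 < δ) : powMeasure δ (Ioo 0 1) < ⊤ := by
  rw [powMeasure_apply δ measurableSet_Ioo Ioo_subset_Ioi_self]
  exact ((intervalIntegral.integrableOn_Ioo_rpow_iff one_pos).2 hδ).lintegral_lt_top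

lemma le_powMeasure_Ioo {δ : ℝ} (hδ : 0 ≤ δ) {R : ℝ} (hR : 0 < R) :
    ENNReal.ofReal (R ^ (δ + 1)) ≤ powMeasure δ (Ioo R (2 * R)) := by
  rw [powMeasure_apply δ measurableSet_Ioo
    (fun x hx => hR.trans hx.1)]
  calc ENNReal.ofReal (R ^ (δ + 1)) = ∫⁻ _ in Ioo R (2 * R), ENNReal.ofReal (R ^ δ) := by
        rw [setLIntegral_const, Real.volume_Ioo, ← ENNReal.ofReal_mul (by positivity),
          Real.rpow_add_one hR.ne']
        ring_nf
    _ ≤ _ := setLIntegral_mono' measurableSet_Ioo fun x hx =>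
        ENNReal.ofReal_le_ofReal (Real.rpow_le_rpow hR.le hx.1.le hδ)

theorem not_isRestrictedWeakType_H0log {δ p : ℝ} (hp : 1 ≤ p) (hδ : 2 * p - 1 ≤ δ) :
    ¬ IsRestrictedWeakType H0log p δ := by
  rintro ⟨C, hC⟩
  have hfin := powMeasure_Ioo_zero_one_lt_top (δ := δ) (by linarith)
  set B := (C * powMeasure δ (Ioo 0 1)).toReal with hB
  have key : ∀ s : ℝ, 1 ≤ s → (s / 16) ^ p ≤ B := by
    intro s hs
    have hs0 : 0 < s := by linarith
    set R := Real.exp s with hR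
    have hR0 : 0 < R := Real.exp_pos s
    have hR1 : 1 < R := Real.one_lt_exp_iff.2 hs0
    set l := s / 16 * (R ^ 2)⁻¹ with hl
    have hl0 : 0 < l := by positivity
    have hsub : Ioo R (2 * R) ⊆ {y | l < |H0log ((Ioo (0:ℝ) 1).indicator 1) y|} := by
      intro x hx
      have hx1 : 1 < x := hR1.trans hx.1
      have hx0 : 0 < x := by linarith
      have hsx : s ≤ Real.log x := by
        rw [Real.le_log_iff_exp_le hx0]; exact hx.1.le
      refine lt_of_lt_of_le ?_ (le_abs_self (H0log _ x))
      rw [H0log, Real.rpow_neg hx0.le, Real.rpow_two]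
      calc l < ((2 * R) ^ 2)⁻¹ * (s / 2) := by
            rw [hl, mul_pow, mul_inv]
            have : 0 < s * (R ^ 2)⁻¹ := by positivity
            linarith
        _ ≤ (x ^ 2)⁻¹ * (Real.log x / 2) := by
            gcongr
            exact hx.2.le
        _ ≤ _ := by
            gcongr
            exact log_div_two_le_integral hx1
    have h := hC (Ioo 0 1) measurableSet_Ioo hfin l hl0
    have h2 : ENNReal.ofReal (l ^ p * R ^ (δ + 1)) ≤ C * powMeasure δ (Ioo 0 1) := by
      rw [ENNReal.ofReal_mul (by positivity)]
      refine le_trans ?_ h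
      gcongr
      exact (le_powMeasure_Ioo (by linarith) hR0).trans (measure_mono hsub)
    rw [ENNReal.ofReal_le_iff_le_toReal (ENNReal.mul_lt_top (by simp) hfin).ne] at h2
    refine le_trans ?_ h2
    have h3 : l ^ p * R ^ (δ + 1) = (s / 16) ^ p * R ^ (δ + 1 - 2 * p) := by
      rw [hl, Real.mul_rpow (by positivity) (by positivity), ← Real.rpow_two,
        ← Real.rpow_neg hR0.le, ← Real.rpow_mul hR0.le, mul_assoc, ← Real.rpow_add hR0]
      ring_nf
    rw [h3]
    exact le_mul_of_one_le_right (by positivity) (Real.one_le_rpow hR1.le (by linarith))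
  have hB0 : 0 ≤ B := ENNReal.toReal_nonneg
  have h := key (16 * (B + 1)) (by linarith)
  have h4 : B + 1 ≤ (16 * (B + 1) / 16) ^ p := by
    rw [mul_div_cancel_left₀ _ (by norm_num)]
    exact Real.self_le_rpow_of_one_le (by linarith) hp
  linarith

theorem stmt6 (δ p : ℝ) (hp : 1 ≤ p) :
    (δ < 2 * p - 1 → IsStrongType H0log p δ) ∧
    (2 * p - 1 ≤ δ → ¬ IsRestrictedWeakType H0log p δ) :=
  ⟨isStrongType_H0log hp, not_isRestrictedWeakType_H0log hp⟩

end
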